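/- Let (X,T) be a minimal Cantor system and f ∈ C(X,ℤ) such that [f] is a nonzero positive element in G(X,T)/Inf(X,T). Then there is an ε > 0 such that for every clopen set A with diameter less than ε and every x ∈ A, Σ_{j=0}^{r_A(x)-1} f(T^j x) > 0. -/

import Mathlib

open Set Filter Topology MeasureTheory

/-- A minimal homeomorphism: every two-sided orbit is dense. -/
def IsMinimal {X : Type*} [TopologicalSpace X] (T : X ≃ₜ X) : Prop :=
  ∀ x : X, Dense (Set.range fun n : ℤ => (T.toEquiv ^ n) x)

/-- First return time of `x` to the set `A` under the map `T`. -/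
noncomputable def retTime {X : Type*} (T : X → X) (A : Set X) (x : X) : ℕ :=
  sInf {n : ℕ | 0 < n ∧ T^[n] x ∈ A}

/-- `f` is a `T`-coboundary (with continuous transfer function). -/
def IsCob {X : Type*} [TopologicalSpace X] (T : X → X) (f : X → ℤ) : Prop :=
  ∃ g : X → ℤ, Continuous g ∧ ∀ x, f x = g x - g (T x)

/-- `[f]` is a nonzero positive class in `G(X,T) = C(X,ℤ)/∂_T`. -/
def PosClass {X : Type*} [TopologicalSpace X] (T : X → X) (f : X → ℤ) : Prop :=
  ∃ u : X → ℤ, Continuous u ∧ (∀ x, 0 ≤ u x) ∧ (∃ x, u x ≠ 0) ∧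
    IsCob T (fun x => f x - u x)

/-- The indicator function of a set, with values in `ℤ`. -/
noncomputable def ind {X : Type*} (A : Set X) : X → ℤ := A.indicator fun _ => 1

/-- `[f]` is a nonzero positive class in `G(X,T)/Inf`: `f` is a nonnegative nonzero
continuous function plus a function integrating to zero against every invariant measure. -/
def PosClassInf {X : Type*} [TopologicalSpace X] [MeasurableSpace X]
    (T : X → X) (f : X → ℤ) : Prop :=
  ∃ u k : X → ℤ, Continuous u ∧ (∀ x, 0 ≤ u x) ∧ (∃ x, u x ≠ 0) ∧ Continuous k ∧
    (∀ μ : Measure X, IsProbabilityMeasure μ → Measure.map T μ = μ →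
      ∫ x, (k x : ℝ) ∂μ = 0) ∧
    (∀ x, f x = u x + k x)

theorem aux_hit {X : Type*} [TopologicalSpace X] [CompactSpace X] (T : X ≃ₜ X)
    (hmin : IsMinimal T) (U : Set X) (hU : IsOpen U) (hne : U.Nonempty) (y : X) :
    ∃ m : ℕ, 0 < m ∧ (⇑T)^[m] y ∈ U := by
  have hc : ∀ n : ℤ, Continuous (fun x => (T.toEquiv ^ n) x) := by
    intro n
    cases n with
    | ofNat n =>
      have : (fun x => (T.toEquiv ^ (Int.ofNat n)) x) = (⇑T)^[n] := by
        ext x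
        simp [Equiv.Perm.iterate_eq_pow]
        rw [← Equiv.Perm.iterate_eq_pow]; rfl
      rw [this]; exact T.continuous.iterate n
    | negSucc n =>
      have : (fun x => (T.toEquiv ^ (Int.negSucc n)) x) = (⇑T.symm)^[n+1] := by
        ext x
        rw [zpow_negSucc, ← inv_pow, ← Equiv.Perm.iterate_eq_pow]; rfl
      rw [this]; exact T.symm.continuous.iterate _
  obtain ⟨F, hF⟩ := isCompact_univ.elim_finite_subcover
    (fun n : ℤ => (fun x => (T.toEquiv ^ n) x) ⁻¹' U) (fun n => hU.preimage (hc n))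
    (by
      intro x _
      obtain ⟨_, hz, n, rfl⟩ := (hmin x).inter_open_nonempty U hU hne
      exact mem_iUnion.2 ⟨n, hz⟩)
  obtain ⟨N, hN⟩ : ∃ N : ℕ, ∀ n ∈ F, -(N:ℤ) ≤ n := by
    refine ⟨∑ n ∈ F, n.natAbs, fun n hn => ?_⟩
    have := Finset.single_le_sum (f := fun n : ℤ => n.natAbs) (fun _ _ => Nat.zero_le _) hn
    omega
  have h := hF (mem_univ ((⇑T)^[N+1] y))
  simp only [mem_iUnion, mem_preimage] at h
  obtain ⟨n, hn, h⟩ := h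
  have := hN n hn
  obtain ⟨m, hm⟩ : ∃ m : ℕ, (m : ℤ) = n + (N + 1 : ℕ) := ⟨(n + (N+1:ℕ)).toNat, by omega⟩
  refine ⟨m, by omega, ?_⟩
  have e : ∀ k : ℕ, ∀ z, (⇑T)^[k] z = (T.toEquiv ^ (k:ℤ)) z := by
    intro k z
    rw [zpow_natCast, ← Equiv.Perm.iterate_eq_pow]; rfl
  rw [e, hm, zpow_add, Equiv.Perm.mul_apply, ← e]
  exact h

theorem aux_aper {X : Type*} [MetricSpace X] [CompactSpace X] [PerfectSpace X] (T : X ≃ₜ X)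
    (hmin : IsMinimal T) (j : ℕ) (hj : 0 < j) (x : X) : (⇑T)^[j] x ≠ x := by
  intro h
  set P : Set X := (fun i => (⇑T)^[i] x) '' (Set.Iio j) with hP
  have hfin : P.Finite := (Set.finite_Iio j).image _
  have hinf : Infinite X := by
    have : (𝓝[≠] x).NeBot := inferInstance
    exact Set.infinite_univ_iff.1 (infinite_of_mem_nhds x univ_mem)
  obtain ⟨m, -, hm⟩ := aux_hit T hmin Pᶜ hfin.isClosed.isOpen_compl hfin.infinite_compl.nonempty x
  apply hm
  refine ⟨m % j, Nat.mod_lt _ hj, ?_⟩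
  exact (show Function.IsPeriodicPt (⇑T) j x from h).iterate_mod_apply m

theorem aux_dist {X : Type*} [MetricSpace X] [CompactSpace X] [PerfectSpace X] (T : X ≃ₜ X)
    (hmin : IsMinimal T) (N : ℕ) :
    ∃ ε > (0:ℝ), ∀ j, 0 < j → j < N → ∀ x, ε ≤ dist x ((⇑T)^[j] x) := by
  induction N with
  | zero => exact ⟨1, one_pos, fun j _ h => absurd h (by omega)⟩
  | succ N ih =>
    obtain ⟨ε, hε, h⟩ := ih
    rcases Nat.eq_zero_or_pos N with h0 | h0
    · exact ⟨1, one_pos, fun j _ h => absurd h (by omega)⟩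
    obtain ⟨δ, hδ, h'⟩ : ∃ δ > (0:ℝ), ∀ x, δ ≤ dist x ((⇑T)^[N] x) := by
      rcases isEmpty_or_nonempty X with hX | hX
      · exact ⟨1, one_pos, fun x => (hX.false x).elim⟩
      obtain ⟨z, -, hz⟩ := isCompact_univ.exists_isMinOn (univ_nonempty (α := X))
        (f := fun x => dist x ((⇑T)^[N] x))
        (continuous_id.dist (T.continuous.iterate N)).continuousOn
      exact ⟨_, dist_pos.2 (aux_aper T hmin N h0 z).symm, fun x => hz (mem_univ x)⟩
    refine ⟨min ε δ, lt_min hε hδ, fun j hj hjN x => ?_⟩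
    rcases Nat.lt_succ_iff_lt_or_eq.1 hjN with hl | rfl
    · exact (min_le_left _ _).trans (h j hj hl x)
    · exact (min_le_right _ _).trans (h' x)

open scoped ENNReal in
theorem aux_emp {X : Type*} [MetricSpace X] [MeasurableSpace X] [BorelSpace X]
    (T : X ≃ₜ X) (n : ℕ) (hn : 0 < n) (x : X) :
    ∃ μ : ProbabilityMeasure X, ∀ g : X → ℝ, Continuous g →
      ∫ y, g y ∂(μ : Measure X) = birkhoffAverage ℝ (⇑T) g n x := by
  have hp : IsProbabilityMeasure
      ((n : ℝ≥0∞)⁻¹ • ∑ j ∈ Finset.range n, Measure.dirac ((⇑T)^[j] x)) := by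
    constructor
    simp
    exact ENNReal.inv_mul_cancel (by simpa using hn.ne') (by simp)
  refine ⟨⟨_, hp⟩, fun g hg => ?_⟩
  simp only [ProbabilityMeasure.coe_mk, integral_smul_measure]
  rw [integral_finsetSum_measure (fun i _ => integrable_dirac (by simp))]
  simp [birkhoffAverage, birkhoffSum]

theorem aux_pos {X : Type*} [MetricSpace X] [CompactSpace X]
    [MeasurableSpace X] [BorelSpace X]
    (T : X ≃ₜ X) (f : X → ℤ) (hf : Continuous f)
    (hpos : ∀ μ : Measure X, IsProbabilityMeasure μ → Measure.map T μ = μ →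
      0 < ∫ x, (f x : ℝ) ∂μ) :
    ∃ N : ℕ, ∀ n ≥ N, ∀ x, 0 < ∑ j ∈ Finset.range n, f ((⇑T)^[j] x) := by
  by_contra! hcon
  choose n hn x hx using fun N => hcon (N+1)
  choose μ hμ using fun N => aux_emp T (n N) (by have := hn N; omega) (x N)
  obtain ⟨ν, hν⟩ : ∃ ν, Tendsto μ (Ultrafilter.of atTop : Ultrafilter ℕ) (𝓝 ν) := by
    obtain ⟨ν, -, h⟩ := isCompact_univ.ultrafilter_le_nhds
      ((Ultrafilter.of atTop).map μ) (by simp)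
    exact ⟨ν, h⟩
  rw [ProbabilityMeasure.tendsto_iff_forall_integral_tendsto] at hν
  have hν' : ∀ g : X → ℝ, Continuous g →
      Tendsto (fun N => birkhoffAverage ℝ (⇑T) g (n N) (x N))
        (Ultrafilter.of atTop : Ultrafilter ℕ) (𝓝 (∫ y, g y ∂(ν : Measure X))) := by
    intro g hg
    have := hν (BoundedContinuousFunction.mkOfCompact ⟨g, hg⟩)
    simp only [BoundedContinuousFunction.mkOfCompact_apply, ContinuousMap.coe_mk] at this
    refine this.congr fun N => hμ N g hg
  have hntop : Tendsto (fun N => (n N : ℝ)) atTop atTop :=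
    tendsto_natCast_atTop_atTop.comp
      (tendsto_atTop_mono (fun N => by have := hn N; simp only [id]; omega) tendsto_id)
  have hinv : Measure.map T (ν : Measure X) = ν := by
    have : IsProbabilityMeasure (Measure.map T (ν : Measure X)) :=
      Measure.isProbabilityMeasure_map T.continuous.aemeasurable
    refine ext_of_forall_integral_eq_of_IsFiniteMeasure fun g => ?_
    rw [integral_map T.continuous.aemeasurable g.continuous.aestronglyMeasurable]
    refine tendsto_nhds_unique (hν' _ (g.continuous.comp T.continuous)) ?_
    have hd : Tendsto (fun N => birkhoffAverage ℝ (⇑T) (g ∘ T) (n N) (x N) -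
        birkhoffAverage ℝ (⇑T) g (n N) (x N)) atTop (𝓝 0) := by
      refine squeeze_zero_norm (a := fun N => (2 * ‖g‖) / (n N : ℝ)) (fun N => ?_)
        (Tendsto.const_div_atTop hntop _)
      have e : birkhoffAverage ℝ (⇑T) (g ∘ T) (n N) (x N)
          = birkhoffAverage ℝ (⇑T) g (n N) (T (x N)) := by
        simp only [birkhoffAverage, birkhoffSum, Function.comp, ← Function.iterate_succ_apply',
          ← Function.iterate_succ_apply]
      rw [e, birkhoffAverage_apply_sub_birkhoffAverage, norm_smul, norm_inv, div_eq_inv_mul]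
      simp only [RCLike.norm_natCast]
      gcongr
      rw [← dist_eq_norm]
      exact g.dist_le_two_norm _ _
    have := (hd.mono_left (Ultrafilter.of_le atTop)).add (hν' g g.continuous)
    simpa [Function.comp_def] using this
  have h1 := hpos ν inferInstance hinv
  have h2 := hν' (fun y => (f y : ℝ)) (continuous_of_discreteTopology.comp hf)
  have h3 := le_of_tendsto h2 (b := 0) (Eventually.of_forall fun N => by
    simp only [birkhoffAverage, birkhoffSum, smul_eq_mul]
    have := hx N
    have : ((∑ j ∈ Finset.range (n N), f ((⇑T)^[j] (x N)) : ℤ) : ℝ) ≤ 0 := by exact_mod_cast this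
    push_cast at this
    exact mul_nonpos_of_nonneg_of_nonpos (by positivity) this)
  exact absurd h1 (not_lt.2 h3)

theorem aux_int {X : Type*} [MetricSpace X] [CompactSpace X]
    [MeasurableSpace X] [BorelSpace X]
    (T : X ≃ₜ X) (hmin : IsMinimal T) (u : X → ℤ) (hu : Continuous u) (h0 : ∀ x, 0 ≤ u x)
    (hne : ∃ x, u x ≠ 0) (μ : Measure X) (hμ : IsProbabilityMeasure μ)
    (hT : Measure.map T μ = μ) : 0 < ∫ x, (u x : ℝ) ∂μ := by
  have hc : Continuous (fun x => (u x : ℝ)) := continuous_of_discreteTopology.comp hu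
  have hi : Integrable (fun x => (u x : ℝ)) μ :=
    hc.integrable_of_hasCompactSupport (HasCompactSupport.of_compactSpace _)
  rw [integral_pos_iff_support_of_nonneg (fun x => by simpa using h0 x) hi, pos_iff_ne_zero]
  intro hz
  have ho : IsOpen (Function.support (fun x => (u x : ℝ))) := hc.isOpen_support
  have hp : MeasurePreserving T μ μ := ⟨T.continuous.measurable, hT⟩
  have hcov : (univ : Set X) ⊆ ⋃ m : ℕ, (⇑T)^[m] ⁻¹' (Function.support (fun x => (u x : ℝ))) := by
    intro y _
    obtain ⟨m, -, hm⟩ := aux_hit T hmin _ ho (by obtain ⟨x, hx⟩ := hne; exact ⟨x, by simpa using hx⟩) y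
    exact mem_iUnion.2 ⟨m, hm⟩
  have : μ univ = 0 := measure_mono_null hcov (measure_iUnion_null fun m => by
    rw [(hp.iterate m).measure_preimage ho.measurableSet.nullMeasurableSet]; exact hz)
  simp at this

theorem stmt9 {X : Type*} [MetricSpace X] [CompactSpace X] [PerfectSpace X]
    [TotallyDisconnectedSpace X] [MeasurableSpace X] [BorelSpace X]
    (T : X ≃ₜ X) (hmin : IsMinimal T)
    (f : X → ℤ) (hf : Continuous f)
    (hfpos : PosClassInf (⇑T) f) :
    ∃ ε > (0 : ℝ), ∀ A : Set X, IsClopen A → Metric.diam A < ε →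
      ∀ x ∈ A, 0 < ∑ j ∈ Finset.range (retTime (⇑T) A x), f ((⇑T)^[j] x) := by
  obtain ⟨u, k, hu, hu0, hune, hk, hkint, hfe⟩ := hfpos
  obtain ⟨N, hN⟩ := aux_pos T f hf (fun μ hμ hT => by
    have hcu : Continuous (fun x => (u x : ℝ)) := continuous_of_discreteTopology.comp hu
    have hck : Continuous (fun x => (k x : ℝ)) := continuous_of_discreteTopology.comp hk
    have h1 := aux_int T hmin u hu hu0 hune μ hμ hT
    have h2 := hkint μ hμ hT
    simp only [hfe, Int.cast_add]
    rw [integral_add (hcu.integrable_of_hasCompactSupport (HasCompactSupport.of_compactSpace _))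
      (hck.integrable_of_hasCompactSupport (HasCompactSupport.of_compactSpace _)), h2, add_zero]
    exact h1)
  obtain ⟨ε, hε, hd⟩ := aux_dist T hmin N
  refine ⟨ε, hε, fun A hA hdiam x hx => hN _ ?_ x⟩
  obtain ⟨hr, hrA⟩ : 0 < retTime (⇑T) A x ∧ (⇑T)^[retTime (⇑T) A x] x ∈ A :=
    Nat.sInf_mem (s := {n : ℕ | 0 < n ∧ (⇑T)^[n] x ∈ A}) (aux_hit T hmin A hA.isOpen ⟨x, hx⟩ x)
  by_contra! hlt
  have h1 := hd _ hr hlt x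
  have h2 := Metric.dist_le_diam_of_mem Metric.isBounded_of_compactSpace hx hrA
  linarith
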